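/- arXiv:math/0611006 — 2 statements merged into one kernel-verified Lean document; each statement's English description precedes it below -/
import Mathlib

section
/- Let H be a discrete ω-dimensional poc-set, let B ⊆ H be a finite filter base (i.e., a finite subset such that no b, c ∈ B satisfy b ≤ c*), and let Σ be an almost-equality class of H° such that Σ ∩ S_b ≠ ∅ for every b ∈ B. Then Σ ∩ ⋂_{b∈B} S_b ≠ ∅; that is, there is an ultrafilter in Σ containing all elements of B. -/
universe u

/-- A poc-set: a partially ordered set with minimum `zero` and an order-reversing
involution `star` such that `h ≤ star h` implies `h = zero`. -/
structure PocSet (H : Type u) [PartialOrder H] : Type u where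
  star : H → H
  zero : H
  zero_le : ∀ h : H, zero ≤ h
  star_star : ∀ h : H, star (star h) = h
  star_antitone : ∀ a b : H, a ≤ b → star b ≤ star a
  eq_zero_of_le_star : ∀ h : H, h ≤ star h → h = zero

namespace PocSet

variable {H : Type u} [PartialOrder H]

/-- An element is proper if it is neither `0` nor `0*`. -/
def Proper (P : PocSet H) (h : H) : Prop := h ≠ P.zero ∧ h ≠ P.star P.zero

/-- A poc-set is discrete if every interval between proper elements is finite. -/
def IsDiscrete (P : PocSet H) : Prop :=
  ∀ a b : H, P.Proper a → P.Proper b → (Set.Icc a b).Finite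

/-- Two elements are transverse if none of the four nesting relations holds. -/
def Transverse (P : PocSet H) (a b : H) : Prop :=
  ¬ a ≤ b ∧ ¬ P.star a ≤ b ∧ ¬ a ≤ P.star b ∧ ¬ P.star a ≤ P.star b

/-- ω-dimensionality: no infinite subset of pairwise transverse elements. -/
def OmegaDimensional (P : PocSet H) : Prop :=
  ∀ S : Set H, S.Pairwise P.Transverse → S.Finite

/-- Ultrafilter on a poc-set: (UF1) exactly one of `h`, `h*` belongs;
(UF2) no `h ≤ k*` for members `h, k`. -/
def IsUltra (P : PocSet H) (α : Set H) : Prop :=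
  (∀ h : H, h ∈ α ↔ P.star h ∉ α) ∧ ∀ h ∈ α, ∀ k ∈ α, ¬ h ≤ P.star k

/-- An infinite strictly descending chain of elements of `ξ`. -/
def DescChainIn (ξ : Set H) (c : ℕ → H) : Prop :=
  (∀ n, c n ∈ ξ) ∧ ∀ n, c (n + 1) < c n

/-- Principal ultrafilter: an ultrafilter with no infinite strictly descending chain. -/
def IsPrincipal (P : PocSet H) (α : Set H) : Prop :=
  P.IsUltra α ∧ ¬ ∃ c : ℕ → H, DescChainIn α c

/-- The set of minimal elements of `α`. -/
def minset (α : Set H) : Set H := {a ∈ α | ∀ b ∈ α, b ≤ a → b = a}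

/-- Almost equality: both differences are finite. -/
def AlmostEq (α β : Set H) : Prop := (α \ β).Finite ∧ (β \ α).Finite

/-- `Sg` is an almost-equality class of ultrafilters on `P`. -/
def IsAEClass (P : PocSet H) (Sg : Set (Set H)) : Prop :=
  ∃ α : Set H, P.IsUltra α ∧ Sg = {β | P.IsUltra β ∧ AlmostEq α β}

-- The Tychonoff topology on subsets of `H`, induced from the product topology
-- on `H → Bool` (with `Bool` discrete) via characteristic functions.
open Classical in
noncomputable def tychonoff (H : Type u) : TopologicalSpace (Set H) :=
  TopologicalSpace.induced (fun (α : Set H) (h : H) => decide (h ∈ α)) inferInstance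

/-- The median of three subsets of `H`. -/
def med (α β γ : Set H) : Set H := (α ∩ β) ∪ (β ∩ γ) ∪ (α ∩ γ)

end PocSet

open PocSet

open PocSet

namespace PocSet

variable {H : Type u} [PartialOrder H]

theorem le_star_comm (P : PocSet H) {a b : H} (h : a ≤ P.star b) : b ≤ P.star a := by
  simpa only [P.star_star] using P.star_antitone _ _ h

/-- The ultrafilter obtained from `α` by forcing every element of `B` to belong to it. -/
def force (P : PocSet H) (α B : Set H) : Set H :=
  {h | (∃ b ∈ B, b ≤ h) ∨ h ∈ α ∧ ∀ b ∈ B, ¬ h ≤ P.star b}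

theorem IsUltra.force {P : PocSet H} {α B : Set H} (hα : P.IsUltra α)
    (hB : ∀ b ∈ B, ∀ c ∈ B, ¬ b ≤ P.star c) : P.IsUltra (P.force α B) := by
  have key : ∀ h ∈ P.force α B, ∀ k ∈ P.force α B, ¬ h ≤ P.star k := by
    rintro h (⟨b, hb, hbh⟩ | ⟨hh, hh'⟩) k (⟨c, hc, hck⟩ | ⟨hk, hk'⟩) hle
    · exact hB b hb c hc (hbh.trans (hle.trans (P.star_antitone _ _ hck)))
    · exact hk' b hb (P.le_star_comm (hbh.trans hle))
    · exact hh' c hc (hle.trans (P.star_antitone _ _ hck))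
    · exact hα.2 h hh k hk hle
  refine ⟨fun h => ⟨fun hh hs => key h hh _ hs (P.star_star h).ge, fun hs => ?_⟩, key⟩
  by_contra hh
  have hup : ∀ b ∈ B, ¬ b ≤ h := fun b hb hbh => hh (Or.inl ⟨b, hb, hbh⟩)
  have hsup : ∀ b ∈ B, ¬ b ≤ P.star h := fun b hb hbh => hs (Or.inl ⟨b, hb, hbh⟩)
  have hmem : h ∉ α := fun hm =>
    hh (Or.inr ⟨hm, fun b hb hle => hsup b hb (P.le_star_comm hle)⟩)
  have hsmem : P.star h ∉ α := fun hm =>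
    hs (Or.inr ⟨hm, fun b hb hle => hup b hb (by
      simpa only [P.star_star] using P.le_star_comm hle)⟩)
  exact hmem ((hα.1 h).2 hsmem)

theorem IsUltra.almostEq_force {P : PocSet H} {α B : Set H} (hα : P.IsUltra α)
    (hB : B.Finite) (hfin : ∀ b ∈ B, {x ∈ α | x ≤ P.star b}.Finite) :
    AlmostEq α (P.force α B) := by
  have hU : (⋃ b ∈ B, {x ∈ α | x ≤ P.star b}).Finite := hB.biUnion hfin
  refine ⟨hU.subset ?_, (hU.image P.star).subset ?_⟩
  · rintro x ⟨hx, hxf⟩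
    by_contra hn
    refine hxf (Or.inr ⟨hx, fun b hb hle => hn ?_⟩)
    exact Set.mem_biUnion hb ⟨hx, hle⟩
  · rintro y ⟨⟨b, hb, hby⟩ | ⟨hy, -⟩, hyα⟩
    · refine ⟨P.star y, Set.mem_biUnion hb ⟨?_, P.star_antitone _ _ hby⟩, P.star_star y⟩
      by_contra h
      exact hyα ((hα.1 y).2 h)
    · exact absurd hy hyα

end PocSet

theorem stmt4 {H : Type u} [PartialOrder H] (P : PocSet H)
    (hdisc : P.IsDiscrete) (homega : P.OmegaDimensional)
    (B : Finset H) (hbase : ∀ b ∈ B, ∀ c ∈ B, ¬ b ≤ P.star c)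
    (Sg : Set (Set H)) (hSg : IsAEClass P Sg)
    (hmeets : ∀ b ∈ B, ∃ α ∈ Sg, b ∈ α) :
    ∃ α ∈ Sg, ∀ b ∈ B, b ∈ α := by
  obtain ⟨α, hα, rfl⟩ := hSg
  refine ⟨P.force α B, ⟨hα.force hbase, hα.almostEq_force B.finite_toSet fun b hb => ?_⟩,
    fun b hb => Or.inl ⟨b, hb, le_rfl⟩⟩
  obtain ⟨β, ⟨hβ, hαβ⟩, hbβ⟩ := hmeets b hb
  refine hαβ.1.subset ?_
  rintro x ⟨hx, hxb⟩
  exact ⟨hx, fun hxβ => hβ.2 x hxβ b hbβ hxb⟩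
end

section
/- Let H be a discrete ω-dimensional poc-set, let Σ be an almost-equality class of H°, and let a ∈ H be proper. Then a is transverse to Σ (i.e., both S_a ∩ Σ and S_{a*} ∩ Σ are nonempty) if and only if there exists an ultrafilter γ ∈ Σ with a ∈ min(γ). -/
universe u

open PocSet

open PocSet

namespace PocSet

theorem AlmostEq.trans {H : Type u} {α β γ : Set H} (h₁ : AlmostEq α β) (h₂ : AlmostEq β γ) :
    AlmostEq α γ := by
  refine ⟨(h₁.1.union h₂.1).subset ?_, (h₁.2.union h₂.2).subset ?_⟩
  · rintro x ⟨hx, hx'⟩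
    by_cases h : x ∈ β
    exacts [Or.inr ⟨h, hx'⟩, Or.inl ⟨hx, h⟩]
  · rintro x ⟨hx, hx'⟩
    by_cases h : x ∈ β
    exacts [Or.inl ⟨h, hx'⟩, Or.inr ⟨hx, h⟩]

theorem AlmostEq.symm {H : Type u} {α β : Set H} (h : AlmostEq α β) : AlmostEq β α := ⟨h.2, h.1⟩

variable {H : Type u} [PartialOrder H]

theorem Proper.not_star_le {P : PocSet H} {a : H} (ha : P.Proper a) : ¬ P.star a ≤ a := by
  intro h
  have h0 := P.eq_zero_of_le_star (P.star a) (by rwa [P.star_star])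
  exact ha.2 (by rw [← h0, P.star_star])

/-- Replace the members of `F` by their complements in `α`. -/
def flip (P : PocSet H) (α F : Set H) : Set H := {h | (h ∈ α ∧ h ∉ F) ∨ P.star h ∈ F}

/-- Flipping a set `F` that is downward closed in an ultrafilter and bounded above by a proper
element yields an ultrafilter. -/
theorem IsUltra.flip {P : PocSet H} {α F : Set H} (hα : P.IsUltra α) (hF : F ⊆ α)
    (hdown : ∀ k ∈ α, ∀ h ∈ F, k ≤ h → k ∈ F) {a : H} (ha : P.Proper a)
    (hle : ∀ h ∈ F, h ≤ a) : P.IsUltra (P.flip α F) := by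
  refine ⟨fun h => ?_, ?_⟩
  · have h₁ := hα.1 h
    have h₂ := @hF h
    have h₃ := @hF (P.star h)
    simp only [PocSet.flip, Set.mem_ofPred_eq, P.star_star]
    tauto
  · rintro h (⟨hh, hhF⟩ | hh) k (⟨hk, hkF⟩ | hk) hhk
    · exact hα.2 h hh k hk hhk
    · exact hhF (hdown h hh _ hk hhk)
    · refine hkF (hdown k hk _ hh ?_)
      simpa only [P.star_star] using P.star_antitone _ _ hhk
    · refine ha.not_star_le (le_trans ?_ (hhk.trans (hle _ hk)))
      simpa only [P.star_star] using P.star_antitone _ _ (hle _ hh)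

theorem almostEq_flip (P : PocSet H) (α : Set H) {F : Set H} (hfin : F.Finite) :
    AlmostEq α (P.flip α F) := by
  refine ⟨hfin.subset ?_, (hfin.image P.star).subset ?_⟩
  · rintro x ⟨hx, hx'⟩
    by_contra h
    exact hx' (Or.inl ⟨hx, h⟩)
  · rintro x ⟨⟨hx, -⟩ | hx, hx'⟩
    exacts [absurd hx hx', ⟨_, hx, P.star_star x⟩]

end PocSet

theorem stmt6 {H : Type u} [PartialOrder H] (P : PocSet H)
    (hdisc : P.IsDiscrete) (homega : P.OmegaDimensional)
    (Sg : Set (Set H)) (hSg : IsAEClass P Sg)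
    (a : H) (ha : P.Proper a) :
    ((∃ α ∈ Sg, a ∈ α) ∧ (∃ α ∈ Sg, P.star a ∈ α)) ↔ ∃ γ ∈ Sg, a ∈ minset γ := by
  obtain ⟨σ, -, rfl⟩ := hSg
  constructor
  · rintro ⟨⟨α, ⟨hα, hσα⟩, haα⟩, β, ⟨hβ, hσβ⟩, haβ⟩
    have hfin : {h | h ∈ α ∧ h < a}.Finite := by
      refine (hσα.symm.trans hσβ).1.subset fun h hh => ⟨hh.1, fun hhβ => ?_⟩
      exact hβ.2 h hhβ _ haβ (by rw [P.star_star]; exact hh.2.le)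
    refine ⟨P.flip α {h | h ∈ α ∧ h < a}, ⟨?_, hσα.trans (almostEq_flip P α hfin)⟩,
      Or.inl ⟨haα, fun h => lt_irrefl _ h.2⟩, ?_⟩
    · exact hα.flip (fun _ h => h.1) (fun k hk h hh hkh => ⟨hk, hkh.trans_lt hh.2⟩) ha
        fun _ h => h.2.le
    · rintro b (⟨hb, hb'⟩ | hb) hba
      · exact hba.eq_or_lt.resolve_right fun h => hb' ⟨hb, h⟩
      · refine absurd (le_trans ?_ hba) ha.not_star_le
        simpa only [P.star_star] using P.star_antitone _ _ hb.2.le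
  · rintro ⟨γ, ⟨hγ, hσγ⟩, haγ, hmin⟩
    refine ⟨⟨γ, ⟨hγ, hσγ⟩, haγ⟩, P.flip γ {a},
      ⟨?_, hσγ.trans (almostEq_flip P γ (Set.finite_singleton a))⟩, Or.inr (P.star_star a)⟩
    refine hγ.flip (Set.singleton_subset_iff.2 haγ) ?_ ha fun _ h => le_of_eq h
    rintro k hk h rfl hkh
    exact hmin k hk hkh
end
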